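/- For the McAfee matching rule, the construction SNT^t := NT^t = b^t∪s^t when there is no quorum, and SNT^t := ∅ when there is a quorum, is a valid strong no-trade construction satisfying both conditions (a) and (b). -/

import Mathlib

/-!
STATEMENT 9: For the McAfee matching rule, the construction `SNT^t := NT^t = b^t ∪ s^t`
when there is no quorum, and `SNT^t := ∅` when there is a quorum, is a valid strong
no-trade construction satisfying both conditions (a) and (b).
-/

open Finset

attribute [local instance] Classical.propDecidable

noncomputable section

namespace McAfeeStmt

variable {nb ns : ℕ}

/-- `k`-th entry of the descending sequence of bid values over the present bids `B`,
with the dummy bid `+∞` at index 0 and the dummy bid `0` at index `|B| + 1`. -/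
def bSeq (B : Finset (Fin nb)) (b : Fin nb → ℝ) (k : ℕ) : EReal :=
  if k = 0 then ⊤
  else if k ≤ B.card then
    sSup {x : EReal | k ≤ (B.filter fun j => x ≤ (b j : EReal)).card}
  else if k = B.card + 1 then 0
  else ⊥

/-- `k`-th entry of the descending sequence of ask values over the present asks `S`,
with the dummy ask `0` at index 0 and the dummy ask `-∞` past the real asks. -/
def sSeq (S : Finset (Fin ns)) (s : Fin ns → ℝ) (k : ℕ) : EReal :=
  if k = 0 then 0
  else if k ≤ S.card then
    min 0 (sSup {x : EReal | k ≤ (S.filter fun j => x ≤ (s j : EReal)).card})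
  else ⊥

/-- The index `m` of the last bid–ask pair clearing in the efficient trade. -/
def mIdx (B : Finset (Fin nb)) (S : Finset (Fin ns)) (b : Fin nb → ℝ)
    (s : Fin ns → ℝ) : ℕ :=
  sSup {k : ℕ | 0 ≤ bSeq B b k + sSeq S s k}

/-- The candidate McAfee price `p_{m+1} = (b_{m+1} - s_{m+1}) / 2`. -/
def pPrice (B : Finset (Fin nb)) (S : Finset (Fin ns)) (b : Fin nb → ℝ)
    (s : Fin ns → ℝ) : EReal :=
  (bSeq B b (mIdx B S b s + 1) - sSeq S s (mIdx B S b s + 1)) * ((1 / 2 : ℝ) : EReal)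

/-- Case I of the McAfee rule: the price `p_{m+1}` satisfies the `m`-th bid and ask;
then the first `m` pairs trade at price `p_{m+1}`.  Otherwise (Case II) the first
`m - 1` pairs trade, buyers paying `b_m` and sellers receiving `-s_m`. -/
def caseI (B : Finset (Fin nb)) (S : Finset (Fin ns)) (b : Fin nb → ℝ)
    (s : Fin ns → ℝ) : Prop :=
  pPrice B S b s ≤ bSeq B b (mIdx B S b s) ∧ -pPrice B S b s ≤ sSeq S s (mIdx B S b s)

/-- A quorum: at least two bids and at least two asks. -/
def quorum (B : Finset (Fin nb)) (S : Finset (Fin ns)) : Prop :=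
  2 ≤ B.card ∧ 2 ≤ S.card

/-- Rank of bid `i` among the present bids (rank 1 = highest; ties broken by index). -/
def rankB (B : Finset (Fin nb)) (b : Fin nb → ℝ) (i : Fin nb) : ℕ :=
  1 + (B.filter fun j => b i < b j ∨ (b j = b i ∧ j < i)).card

/-- Rank of ask `j` among the present asks. -/
def rankS (S : Finset (Fin ns)) (s : Fin ns → ℝ) (j : Fin ns) : ℕ :=
  1 + (S.filter fun k => s j < s k ∨ (s k = s j ∧ k < j)).card

/-- Buyer `i` trades in the McAfee rule applied to `(B, S)`. -/
def buyerTrades (B : Finset (Fin nb)) (S : Finset (Fin ns)) (b : Fin nb → ℝ)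
    (s : Fin ns → ℝ) (i : Fin nb) : Prop :=
  i ∈ B ∧ quorum B S ∧
    (if caseI B S b s then rankB B b i ≤ mIdx B S b s
     else rankB B b i < mIdx B S b s)

/-- Seller `j` trades in the McAfee rule applied to `(B, S)`. -/
def sellerTrades (B : Finset (Fin nb)) (S : Finset (Fin ns)) (b : Fin nb → ℝ)
    (s : Fin ns → ℝ) (j : Fin ns) : Prop :=
  j ∈ S ∧ quorum B S ∧
    (if caseI B S b s then rankS S s j ≤ mIdx B S b s
     else rankS S s j < mIdx B S b s)

/-- A single-period market: present bids and asks, reported values and departures. -/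
structure Market (nb ns : ℕ) where
  B : Finset (Fin nb)
  S : Finset (Fin ns)
  bv : Fin nb → ℝ
  sv : Fin ns → ℝ
  bd : Fin nb → ℕ
  sd : Fin ns → ℕ

abbrev Agent (nb ns : ℕ) := Fin nb ⊕ Fin ns

def present (M : Market nb ns) : Agent nb ns → Prop
  | .inl i => i ∈ M.B
  | .inr j => j ∈ M.S

def dep (M : Market nb ns) : Agent nb ns → ℕ
  | .inl i => M.bd i
  | .inr j => M.sd j

def signOK : Agent nb ns → ℝ → Prop
  | .inl _, v => 0 < v
  | .inr _, v => v ≤ 0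

def signValid (M : Market nb ns) : Prop :=
  (∀ i ∈ M.B, 0 < M.bv i) ∧ (∀ j ∈ M.S, M.sv j ≤ 0)

/-- The market after agent `x` changes its report to value `v`, departure `d`. -/
def updateReport (M : Market nb ns) : Agent nb ns → ℝ → ℕ → Market nb ns
  | .inl i, v, d =>
      { M with bv := Function.update M.bv i v, bd := Function.update M.bd i d }
  | .inr j, v, d =>
      { M with sv := Function.update M.sv j v, sd := Function.update M.sd j d }

/-- The market with agent `x` absent. -/
def eraseAgent (M : Market nb ns) : Agent nb ns → Market nb ns
  | .inl i => { M with B := M.B.erase i }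
  | .inr j => { M with S := M.S.erase j }

/-- Agent `x` trades in the McAfee rule applied to market `M`. -/
def trades (M : Market nb ns) : Agent nb ns → Prop
  | .inl i => buyerTrades M.B M.S M.bv M.sv i
  | .inr j => sellerTrades M.B M.S M.bv M.sv j

/-- `NT^t`: the present agents for which no trade is possible at any (sign-respecting)
replacement value. -/
def NT (M : Market nb ns) : Set (Agent nb ns) :=
  {x | present M x ∧ ∀ v : ℝ, signOK x v → ¬ trades (updateReport M x v (dep M x)) x}

/-- The agents other than `x` that a construction `F` designates as strong no-trade
and that do not depart in period `t`. -/
def othersSNT (F : Market nb ns → Set (Agent nb ns)) (t : ℕ) (M : Market nb ns)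
    (x : Agent nb ns) : Set (Agent nb ns) :=
  {y | y ∈ F M ∧ y ≠ x ∧ t < dep M y}

/-- Validity of a strong no-trade construction `F` in period `t`:
`F M ⊆ NT M`, and conditions (a) and (b) of the strong no-trade definition. -/
def ValidSNT (t : ℕ) (F : Market nb ns → Set (Agent nb ns)) : Prop :=
  ∀ M : Market nb ns, signValid M →
    (F M ⊆ NT M) ∧
    (∀ x ∈ NT M, t < dep M x →
      ∀ (v : ℝ) (d' : ℕ), signOK x v → t < d' →
        (x ∈ F M ↔ x ∈ F (updateReport M x v d'))) ∧
    (∀ x ∈ F M, t < dep M x →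
      ∀ (v : ℝ) (d' : ℕ), signOK x v → t < d' →
        othersSNT F t (updateReport M x v d') x = othersSNT F t M x ∧
          othersSNT F t (eraseAgent M x) x = othersSNT F t M x)

theorem NT_eq_of_not_quorum {nb ns : ℕ} (M : Market nb ns) (h : ¬ quorum M.B M.S) :
    NT M = {x | present M x} := by
  ext x
  simp only [NT, Set.mem_setOf_eq, and_iff_left_iff_imp]
  intro _ v _ ht
  cases x with
  | inl i => exact h ht.2.1
  | inr j => exact h ht.2.1

theorem quorum_update {nb ns : ℕ} (M : Market nb ns) (x : Agent nb ns) (v : ℝ) (d : ℕ) :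
    quorum (updateReport M x v d).B (updateReport M x v d).S ↔ quorum M.B M.S := by
  cases x <;> rfl

theorem present_update {nb ns : ℕ} (M : Market nb ns) (x y : Agent nb ns) (v : ℝ) (d : ℕ) :
    present (updateReport M x v d) y ↔ present M y := by
  cases x <;> cases y <;> rfl

theorem dep_update {nb ns : ℕ} (M : Market nb ns) (x y : Agent nb ns) (v : ℝ) (d : ℕ)
    (h : y ≠ x) : dep (updateReport M x v d) y = dep M y := by
  cases x <;> cases y <;> simp_all [dep, updateReport, Function.update]

theorem quorum_erase {nb ns : ℕ} (M : Market nb ns) (x : Agent nb ns)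
    (h : quorum (eraseAgent M x).B (eraseAgent M x).S) : quorum M.B M.S := by
  cases x with
  | inl i => exact ⟨h.1.trans (Finset.card_le_card (Finset.erase_subset _ _)), h.2⟩
  | inr j => exact ⟨h.1, h.2.trans (Finset.card_le_card (Finset.erase_subset _ _))⟩

theorem present_erase {nb ns : ℕ} (M : Market nb ns) (x y : Agent nb ns) (h : y ≠ x) :
    present (eraseAgent M x) y ↔ present M y := by
  cases x <;> cases y <;> simp_all [present, eraseAgent]

theorem dep_erase {nb ns : ℕ} (M : Market nb ns) (x y : Agent nb ns) :
    dep (eraseAgent M x) y = dep M y := by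
  cases x <;> cases y <;> rfl

/-- **The McAfee strong no-trade construction is valid**: under no quorum `NT^t` is
the whole set of present bids and asks, and the construction taking `SNT^t := NT^t`
when there is no quorum and `SNT^t := ∅` under a quorum is valid. -/
theorem mcafee_snt_valid (nb ns t : ℕ) :
    (∀ M : Market nb ns, signValid M → ¬ quorum M.B M.S →
      NT M = {x | present M x}) ∧
    ValidSNT t (fun M : Market nb ns => if quorum M.B M.S then ∅ else NT M) := by
  refine ⟨fun M _ h => NT_eq_of_not_quorum M h, ?_⟩
  intro M _
  by_cases hq : quorum M.B M.S
  · refine ⟨by simp [hq], ?_, ?_⟩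
    · intro x _ _ v d _ _
      simp [hq, quorum_update]
    · intro x hx
      simp [hq] at hx
  · refine ⟨by simp [hq], ?_, ?_⟩
    · intro x _ _ v d _ _
      have hu := (quorum_update M x v d).not.mpr hq
      simp only [hq, hu, if_false]
      rw [NT_eq_of_not_quorum M hq, NT_eq_of_not_quorum _ hu]
      exact (present_update M x x v d).symm
    · intro x _ _ v d _ _
      have hu := (quorum_update M x v d).not.mpr hq
      have he : ¬ quorum (eraseAgent M x).B (eraseAgent M x).S :=
        fun h => hq (quorum_erase M x h)
      simp only [othersSNT, hq, hu, he, if_false]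
      rw [NT_eq_of_not_quorum M hq, NT_eq_of_not_quorum _ hu, NT_eq_of_not_quorum _ he]
      constructor
      · ext y
        by_cases hy : y = x
        · simp [hy]
        · simp [hy, present_update, dep_update M x y v d hy]
      · ext y
        by_cases hy : y = x
        · simp [hy]
        · simp [hy, present_erase M x y hy, dep_erase]


end McAfeeStmt
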